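/- Let n ≥ 1, 0 ≤ k ≤ n, and r ≥ 1. The pullback map Φ^* restricts to a linear isomorphism from P_r^-Λ^k(T^n) onto *_{S^n}P_{2r+k-1}Λ^{n-k}_o(S^n), the image under the Hodge star *_{S^n} of the space of odd forms in P_{2r+k-1}Λ^{n-k}(S^n). -/

import Mathlib

open scoped BigOperators
open MeasureTheory

noncomputable section

/-- Vectors in `ℝ^m`. -/
abbrev Vec (m : ℕ) := Fin m → ℝ

/-- Differential `k`-forms on `ℝ^m`, given pointwise as alternating `k`-tensors. -/
abbrev Form (m k : ℕ) := Vec m → (Vec m [⋀^Fin k]→ₗ[ℝ] ℝ)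

/-- A multivariate polynomial has (total) degree at most `r : ℤ`. -/
def degLE {m : ℕ} (r : ℤ) (p : MvPolynomial (Fin m) ℝ) : Prop :=
  ∀ d ∈ p.support, ((d.sum fun _ e => e : ℕ) : ℤ) ≤ r

/-- `P_rΛ^k(ℝ^m)`: differential `k`-forms with polynomial coefficients of degree at most `r`. -/
def PL (m k : ℕ) (r : ℤ) : Set (Form m k) :=
  {α | ∀ v : Fin k → Vec m, ∃ p : MvPolynomial (Fin m) ℝ,
      degLE r p ∧ ∀ x, α x v = MvPolynomial.eval x p}

/-- Interior product with the radial vector field `X = Σ xᵢ ∂/∂xᵢ`. -/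
def iU {m k : ℕ} (β : Form m (k + 1)) : Form m k := fun x => (β x).curryLeft x

/-- `P_r⁻Λ^k(ℝ^m) := i_X P_{r-1}Λ^{k+1}(ℝ^m)`. -/
def PLm (m k : ℕ) (r : ℤ) : Set (Form m k) := iU '' PL m (k + 1) (r - 1)

/-- The reflection negating the `i`-th coordinate, as a map. -/
def reflFun (m : ℕ) (i : Fin m) (u : Vec m) : Vec m := fun j => if j = i then -u j else u j

/-- The reflection negating the `i`-th coordinate, as a linear map. -/
def reflLin (m : ℕ) (i : Fin m) : Vec m →ₗ[ℝ] Vec m :=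
  LinearMap.pi fun j => if j = i then -LinearMap.proj j else LinearMap.proj j

/-- Pullback of an ambient form along the reflection `R_i`. -/
def reflPull (m k : ℕ) (i : Fin m) (α : Form m k) : Form m k :=
  fun x => (α (reflFun m i x)).compLinearMap (reflLin m i)

/-- A form on `ℝ^m` is even if it is invariant under all coordinate reflections. -/
def IsEven (m k : ℕ) (α : Form m k) : Prop := ∀ i, reflPull m k i α = α

/-- A form on `ℝ^m` is odd if every coordinate reflection negates it. -/
def IsOdd (m k : ℕ) (α : Form m k) : Prop := ∀ i, reflPull m k i α = -α

/-- The map `Φ(u) = (u₁², …, u_m²)`. -/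
def Phi (m : ℕ) (u : Vec m) : Vec m := fun i => u i ^ 2

/-- The differential of `Φ` at `u`. -/
def dPhi (m : ℕ) (u : Vec m) : Vec m →ₗ[ℝ] Vec m :=
  LinearMap.pi fun i => (2 * u i) • LinearMap.proj i

/-- Pullback of ambient forms along `Φ`. -/
def phiPull (m k : ℕ) (α : Form m k) : Form m k :=
  fun u => (α (Phi m u)).compLinearMap (dPhi m u)

/-- The standard simplex `T^{m-1} ⊂ ℝ^m`. -/
def simplexSet (m : ℕ) : Set (Vec m) := {x | (∀ i, 0 ≤ x i) ∧ ∑ i, x i = 1}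

/-- The unit sphere `S^{m-1} ⊂ ℝ^m`. -/
def sphereSet (m : ℕ) : Set (Vec m) := {u | ∑ i, u i ^ 2 = 1}

/-- The linear functional `v ↦ ⟨u, v⟩`. -/
def dotLin (m : ℕ) (u : Vec m) : Vec m →ₗ[ℝ] ℝ := ∑ i, u i • LinearMap.proj i

/-- Orthogonal projection onto the tangent space of the sphere at `u`. -/
def projSph (m : ℕ) (u : Vec m) : Vec m →ₗ[ℝ] Vec m :=
  LinearMap.id - (dotLin m u).smulRight u

/-- The linear functional `v ↦ Σ vᵢ`. -/
def sumLin (m : ℕ) : Vec m →ₗ[ℝ] ℝ := ∑ i, LinearMap.proj i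

/-- Orthogonal projection onto the tangent hyperplane `{Σ vᵢ = 0}` of the simplex. -/
def projSim (m : ℕ) : Vec m →ₗ[ℝ] Vec m :=
  LinearMap.id - ((m : ℝ)⁻¹ • sumLin m).smulRight (fun _ => 1)

/-- Differential `k`-forms on a subset `M ⊆ ℝ^m`, encoded at each point by the canonical
alternating tensor on `ℝ^m` that vanishes in the directions normal to `M` (i.e. the
pullback along the inclusion, extended by the tangent projection). -/
abbrev FormOn (m : ℕ) (M : Set (Vec m)) (k : ℕ) := M → (Vec m [⋀^Fin k]→ₗ[ℝ] ℝ)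

/-- Restriction (pullback along the inclusion) of an ambient form to the simplex. -/
def resSim (m k : ℕ) (α : Form m k) : FormOn m (simplexSet m) k :=
  fun x => (α x.1).compLinearMap (projSim m)

/-- Restriction (pullback along the inclusion) of an ambient form to the sphere. -/
def resSph (m k : ℕ) (α : Form m k) : FormOn m (sphereSet m) k :=
  fun u => (α u.1).compLinearMap (projSph m u.1)

/-- `P_rΛ^k(T^{m-1})`. -/
def PLsim (m k : ℕ) (r : ℤ) : Set (FormOn m (simplexSet m) k) := resSim m k '' PL m k r

/-- `P_rΛ^k(S^{m-1})`. -/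
def PLsph (m k : ℕ) (r : ℤ) : Set (FormOn m (sphereSet m) k) := resSph m k '' PL m k r

/-- `P_r⁻Λ^k(T^{m-1})`. -/
def PLmsim (m k : ℕ) (r : ℤ) : Set (FormOn m (simplexSet m) k) := resSim m k '' PLm m k r

/-- `P_r⁻Λ^k(S^{m-1})`. -/
def PLmsph (m k : ℕ) (r : ℤ) : Set (FormOn m (sphereSet m) k) := resSph m k '' PLm m k r

lemma phi_mem_simplex {m : ℕ} {u : Vec m} (hu : u ∈ sphereSet m) :
    Phi m u ∈ simplexSet m :=
  ⟨fun _ => sq_nonneg _, hu⟩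

/-- Pullback `Φ^* : Λ^k(T^{m-1}) → Λ^k(S^{m-1})` along `Φ : S^{m-1} → T^{m-1}`. -/
def phiPullTS (m k : ℕ) (a : FormOn m (simplexSet m) k) : FormOn m (sphereSet m) k :=
  fun u => (a ⟨Phi m u.1, phi_mem_simplex u.2⟩).compLinearMap
    ((dPhi m u.1).comp (projSph m u.1))

lemma refl_mem_sphere {m : ℕ} {i : Fin m} {u : Vec m} (hu : u ∈ sphereSet m) :
    reflFun m i u ∈ sphereSet m := by
  have : ∀ j, (reflFun m i u j) ^ 2 = u j ^ 2 := by
    intro j; simp only [reflFun]; split <;> ring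
  simpa only [sphereSet, Set.mem_setOf_eq, this] using hu

/-- Pullback of a form on the sphere along the reflection `R_i`. -/
def reflPullSph (m k : ℕ) (i : Fin m) (α : FormOn m (sphereSet m) k) :
    FormOn m (sphereSet m) k :=
  fun u => (α ⟨reflFun m i u.1, refl_mem_sphere u.2⟩).compLinearMap (reflLin m i)

/-- A form on the sphere is even if it is invariant under all coordinate reflections. -/
def IsEvenSph (m k : ℕ) (α : FormOn m (sphereSet m) k) : Prop :=
  ∀ i, reflPullSph m k i α = α

/-- A form on the sphere is odd if every coordinate reflection negates it. -/
def IsOddSph (m k : ℕ) (α : FormOn m (sphereSet m) k) : Prop :=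
  ∀ i, reflPullSph m k i α = -α

/-- The bubble function `u_N = u₁ ⋯ u_m`. -/
def bubble (m : ℕ) (u : Vec m) : ℝ := ∏ i, u i

/-- Multiplication of a form on the sphere by the bubble function. -/
def bubbleSmul (m k : ℕ) (α : FormOn m (sphereSet m) k) : FormOn m (sphereSet m) k :=
  fun u => bubble m u.1 • α u

/-- Multiplication of an ambient form by the bubble function. -/
def bubbleSmulAmb (m k : ℕ) (α : Form m k) : Form m k :=
  fun u => bubble m u • α u

/-- The standard volume form on `ℝ^m`. -/
def volForm (m : ℕ) : (Vec m) [⋀^Fin m]→ₗ[ℝ] ℝ := (Pi.basisFun ℝ (Fin m)).det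

/-- Iterated interior product: insert the vectors `v 0, …, v (k-1)` into the
first `k` slots of an alternating `(k+j)`-tensor. -/
def contrMany {m : ℕ} : (k : ℕ) → (Fin k → Vec m) → {j : ℕ} →
    ((Vec m) [⋀^Fin (k + j)]→ₗ[ℝ] ℝ) → ((Vec m) [⋀^Fin j]→ₗ[ℝ] ℝ)
  | 0, _, j, α => α.domDomCongr (finCongr (Nat.zero_add j))
  | (k + 1), v, j, α =>
      contrMany k (fun i => v i.succ)
        ((α.domDomCongr (finCongr (by omega : (k + 1) + j = (k + j) + 1))).curryLeft (v 0))

/-- The Hodge star on alternating tensors on `ℝ^m` (standard metric and orientation):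
`(⋆α)(w₁,…,w_{m-k}) = (1/k!) Σ_g α(e_{g 0},…,e_{g(k-1)}) vol(e_{g 0},…,e_{g(k-1)},w₁,…,w_{m-k})`. -/
def starAlt (m k : ℕ) (α : (Vec m) [⋀^Fin k]→ₗ[ℝ] ℝ) : (Vec m) [⋀^Fin (m - k)]→ₗ[ℝ] ℝ :=
  if h : k ≤ m then
    (k.factorial : ℝ)⁻¹ •
      ∑ g : Fin k → Fin m,
        α (fun i => Pi.single (g i) 1) •
          contrMany k (fun i => Pi.single (g i) 1)
            ((volForm m).domDomCongr (finCongr (by omega : m = k + (m - k))))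
  else 0

/-- The Hodge star `⋆_{ℝ^m}` applied pointwise to ambient forms. -/
def starR (m k : ℕ) (α : Form m k) : Form m (m - k) := fun x => starAlt m k (α x)

/-- The wedge product of alternating tensors. -/
def wedgeAlt {m k l : ℕ} (α : (Vec m) [⋀^Fin k]→ₗ[ℝ] ℝ) (β : (Vec m) [⋀^Fin l]→ₗ[ℝ] ℝ) :
    (Vec m) [⋀^Fin (k + l)]→ₗ[ℝ] ℝ :=
  ((TensorProduct.lid ℝ ℝ).toLinearMap.compAlternatingMap (α.domCoprod β)).domDomCongr
    finSumFinEquiv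

/-- The conormal `ν = Σ uᵢ duᵢ` at `u`, as an alternating 1-tensor. -/
def nuForm (m : ℕ) (u : Vec m) : (Vec m) [⋀^Fin 1]→ₗ[ℝ] ℝ :=
  AlternatingMap.ofSubsingleton ℝ (Vec m) ℝ (0 : Fin 1) (dotLin m u)

/-- The extended Hodge star `⋆_{S^{m-1}} α := ⋆_{ℝ^m}(ν ∧ α)` on ambient forms. -/
def starSphAmb (m k : ℕ) (α : Form m k) : Form m (m - (1 + k)) :=
  fun x => starAlt m (1 + k) (wedgeAlt (nuForm m x) (α x))

/-- The Hodge star of a form on the sphere (w.r.t. the round metric and the orientation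
induced by the outward normal), computed as the restriction of `⋆_{ℝ^m}(ν ∧ ·)`. -/
def starSph (m k : ℕ) (α : FormOn m (sphereSet m) k) :
    FormOn m (sphereSet m) (m - (1 + k)) :=
  fun u => (starAlt m (1 + k) (wedgeAlt (nuForm m u.1) (α u))).compLinearMap (projSph m u.1)

/-- Re-indexing a form along an equality of form degrees. -/
def castForm {m k l : ℕ} (h : k = l) (α : Form m k) : Form m l :=
  fun x => (α x).domDomCongr (finCongr h)

/-- Re-indexing a form on a subset along an equality of form degrees. -/
def castFormOn {m : ℕ} {M : Set (Vec m)} {k l : ℕ} (h : k = l) (α : FormOn m M k) :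
    FormOn m M l :=
  fun x => (α x).domDomCongr (finCongr h)

/-- Trace on the boundary of the simplex vanishes: at every boundary point (a point of some
face `xᵢ = 0`), the form vanishes on vectors tangent to that face. -/
def vanishBdry (m k : ℕ) (a : FormOn m (simplexSet m) k) : Prop :=
  ∀ (x : simplexSet m) (i : Fin m), x.1 i = 0 →
    ∀ v : Fin k → Vec m, (∀ j, (∑ l, v j l) = 0 ∧ v j i = 0) → a x v = 0

/-- `P̊_rΛ^k(T^{m-1})`: forms in `P_rΛ^k(T^{m-1})` with vanishing trace on the boundary. -/
def PLosim (m k : ℕ) (r : ℤ) : Set (FormOn m (simplexSet m) k) :=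
  {a ∈ PLsim m k r | vanishBdry m k a}

/-- `P̊_r⁻Λ^k(T^{m-1})`. -/
def PLmosim (m k : ℕ) (r : ℤ) : Set (FormOn m (simplexSet m) k) :=
  {a ∈ PLmsim m k r | vanishBdry m k a}

/-- A form on the sphere vanishes (as an alternating tensor on the tangent space)
at every point of `S^{m-1} ∩ Γ`, where `Γ = ∪ᵢ {uᵢ = 0}`. -/
def zeroOnGammaSph (m k : ℕ) (α : FormOn m (sphereSet m) k) : Prop :=
  ∀ u : sphereSet m, (∃ i, u.1 i = 0) →
    ∀ v : Fin k → Vec m, (∀ j, ∑ l, u.1 l * v j l = 0) → α u v = 0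

/-- An ambient form vanishes (as an alternating tensor) at every point of `Γ`. -/
def zeroOnGammaAmb (m k : ℕ) (α : Form m k) : Prop :=
  ∀ u : Vec m, (∃ i, u i = 0) → α u = 0

/-- The wedge product of forms on a subset. -/
def wedgeOn {m : ℕ} {M : Set (Vec m)} {k l : ℕ} (a : FormOn m M k) (b : FormOn m M l) :
    FormOn m M (k + l) :=
  fun x => wedgeAlt (a x) (b x)

/-- The base region of the parametrization of the simplex. -/
def baseSimplex (n : ℕ) : Set (Fin n → ℝ) := {y | (∀ j, 0 ≤ y j) ∧ ∑ j, y j ≤ 1}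

/-- Parametrization `y ↦ (1 - Σy, y)` of `T^n` over the base region. -/
def simplexParam (n : ℕ) (y : Fin n → ℝ) : Vec (n + 1) := Fin.cons (1 - ∑ j, y j) y

lemma simplexParam_mem {n : ℕ} {y : Fin n → ℝ} (h : y ∈ baseSimplex n) :
    simplexParam n y ∈ simplexSet (n + 1) := by
  constructor
  · intro i
    refine Fin.cases ?_ ?_ i
    · simpa [simplexParam] using sub_nonneg.mpr h.2
    · intro j; simpa [simplexParam] using h.1 j
  · simp [simplexParam, Fin.sum_cons]

/-- The coordinate tangent vectors `∂x/∂y_j = e_{j+1} - e_0` of the parametrization,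
a positively oriented frame for the orientation of `T^n` induced from the outward-normal
orientation of `S^n` via `Φ`. -/
def simplexTangent (n : ℕ) (j : Fin n) : Vec (n + 1) :=
  Fin.cons (-1) (Pi.single j 1)

open Classical in
/-- The integral of an `n`-form over the oriented simplex `T^n`. -/
def integralSimplex (n : ℕ) (ω : FormOn (n + 1) (simplexSet (n + 1)) n) : ℝ :=
  ∫ y : Fin n → ℝ,
    if h : y ∈ baseSimplex n then ω ⟨simplexParam n y, simplexParam_mem h⟩ (simplexTangent n)
    else 0

/-- Forms on a subset that genuinely are pullbacks to the simplex: they vanish in the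
normal directions (canonical representatives). -/
def TangentialSim (m k : ℕ) (a : FormOn m (simplexSet m) k) : Prop :=
  ∀ x, (a x).compLinearMap (projSim m) = a x

/-- Continuity of a form on a subset. -/
def ContFormOn (m : ℕ) (M : Set (Vec m)) (k : ℕ) (a : FormOn m M k) : Prop :=
  ∀ v : Fin k → Vec m, Continuous fun x : M => a x v

/-- The Riemannian volume form of the round sphere `S^{m-1}` (outward-normal orientation),
i.e. the restriction of `⋆_{ℝ^m} ν`. -/
def volSph (m : ℕ) : FormOn m (sphereSet m) (m - 1) :=
  fun u => (starAlt m 1 (nuForm m u.1)).compLinearMap (projSph m u.1)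


/-- The standard basis vectors indexed by a tuple. -/
def stdTuple {m k : ℕ} (g : Fin k → Fin m) : Fin k → Vec m := fun i => Pi.single (g i) 1

lemma vec_eq_sum {m : ℕ} (v : Vec m) : v = ∑ a, v a • (Pi.single a 1 : Vec m) := by
  simpa using pi_eq_sum_univ' v

lemma multilinear_expand {m : ℕ} {ι E : Type*} [Fintype ι] [DecidableEq ι] [AddCommGroup E]
    [Module ℝ E] (f : MultilinearMap ℝ (fun _ : ι => Vec m) E) (v : ι → Vec m) :
    f v = ∑ g : ι → Fin m, (∏ i, v i (g i)) • f (fun i => Pi.single (g i) 1) := by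
  conv_lhs => rw [show v = fun i => ∑ a, v i a • (Pi.single a 1 : Vec m) from
    funext fun i => vec_eq_sum (v i)]
  rw [f.map_sum]
  exact Finset.sum_congr rfl fun g _ => f.map_smul_univ _ _

lemma alternating_ext_stdTuple {m k : ℕ} {f g : Vec m [⋀^Fin k]→ₗ[ℝ] ℝ}
    (h : ∀ t : Fin k → Fin m, f (stdTuple t) = g (stdTuple t)) : f = g := by
  ext v
  have hf := multilinear_expand f.toMultilinearMap v
  have hg := multilinear_expand g.toMultilinearMap v
  simp only [AlternatingMap.coe_multilinearMap] at hf hg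
  rw [hf, hg]
  exact Finset.sum_congr rfl fun t _ => congrArg _ (h t)

/-- Evaluation of alternating tensors on all tuples of standard basis vectors. -/
def evalStd (m k : ℕ) : (Vec m [⋀^Fin k]→ₗ[ℝ] ℝ) →ₗ[ℝ] ((Fin k → Fin m) → ℝ) where
  toFun f t := f (stdTuple t)
  map_add' _ _ := rfl
  map_smul' _ _ := rfl

lemma evalStd_injective (m k : ℕ) : Function.Injective (evalStd m k) := fun _ _ h =>
  alternating_ext_stdTuple fun t => congrFun h t

instance alternating_finite (m k : ℕ) : Module.Finite ℝ (Vec m [⋀^Fin k]→ₗ[ℝ] ℝ) :=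
  Module.Finite.of_injective _ (evalStd_injective m k)

lemma exists_coeff_functional {m k : ℕ} (L : (Vec m [⋀^Fin k]→ₗ[ℝ] ℝ) →ₗ[ℝ] ℝ) :
    ∃ c : (Fin k → Fin m) → ℝ, ∀ f, L f = ∑ t, c t * f (stdTuple t) := by
  obtain ⟨P, hP⟩ := (evalStd m k).exists_leftInverse_of_injective
    (LinearMap.ker_eq_bot.2 (evalStd_injective m k))
  refine ⟨fun t => L (P (Pi.single t 1)), fun f => ?_⟩
  have h1 : f = P (evalStd m k f) := (LinearMap.congr_fun hP f).symm
  conv_lhs => rw [h1, pi_eq_sum_univ' (evalStd m k f)]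
  simp only [map_sum, map_smul, smul_eq_mul]
  exact Finset.sum_congr rfl fun t _ => mul_comm _ _

lemma degLE_sum_smul {m : ℕ} {r : ℤ} {ι : Type*} (s : Finset ι) (c : ι → ℝ)
    (p : ι → MvPolynomial (Fin m) ℝ) (h : ∀ i ∈ s, degLE r (p i)) :
    degLE r (∑ i ∈ s, c i • p i) := by
  intro d hd
  rw [MvPolynomial.mem_support_iff, MvPolynomial.coeff_sum] at hd
  obtain ⟨i, hi, hne⟩ := Finset.exists_ne_zero_of_sum_ne_zero hd
  refine h i hi d ?_
  rw [MvPolynomial.mem_support_iff]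
  intro h0
  simp [h0] at hne

lemma mem_PL_of_functional {m k : ℕ} {r : ℤ} {α : Form m k}
    (h : ∀ t : Fin k → Fin m, ∃ p : MvPolynomial (Fin m) ℝ,
      degLE r p ∧ ∀ x, α x (stdTuple t) = MvPolynomial.eval x p)
    (L : (Vec m [⋀^Fin k]→ₗ[ℝ] ℝ) →ₗ[ℝ] ℝ) :
    ∃ p : MvPolynomial (Fin m) ℝ, degLE r p ∧ ∀ x, L (α x) = MvPolynomial.eval x p := by
  choose p hp hpe using h
  obtain ⟨c, hc⟩ := exists_coeff_functional L
  refine ⟨∑ t, c t • p t, degLE_sum_smul _ _ _ fun t _ => hp t, fun x => ?_⟩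
  simp [hc, hpe, MvPolynomial.smul_eval]

/-- Evaluation at a tuple as a linear functional on alternating tensors. -/
def evalAt {m k : ℕ} (v : Fin k → Vec m) : (Vec m [⋀^Fin k]→ₗ[ℝ] ℝ) →ₗ[ℝ] ℝ where
  toFun f := f v
  map_add' _ _ := rfl
  map_smul' _ _ := rfl

lemma mem_PL_of_stdTuple {m k : ℕ} {r : ℤ} {α : Form m k}
    (h : ∀ t : Fin k → Fin m, ∃ p : MvPolynomial (Fin m) ℝ,
      degLE r p ∧ ∀ x, α x (stdTuple t) = MvPolynomial.eval x p) : α ∈ PL m k r :=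
  fun v => mem_PL_of_functional h (evalAt v)

lemma PL_map {m k l : ℕ} {r : ℤ} {α : Form m k} (hα : α ∈ PL m k r)
    (L : (Vec m [⋀^Fin k]→ₗ[ℝ] ℝ) →ₗ[ℝ] (Vec m [⋀^Fin l]→ₗ[ℝ] ℝ)) :
    (fun x => L (α x)) ∈ PL m l r :=
  fun v => mem_PL_of_functional (fun _ => hα _) (evalAt v ∘ₗ L)

lemma PL_smul {m k : ℕ} {r : ℤ} {α : Form m k} (hα : α ∈ PL m k r) (c : ℝ) :
    c • α ∈ PL m k r :=
  PL_map hα (c • LinearMap.id)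

lemma PL_sub {m k : ℕ} {r : ℤ} {α β : Form m k} (hα : α ∈ PL m k r) (hβ : β ∈ PL m k r) :
    α - β ∈ PL m k r := by
  intro v
  obtain ⟨p, hp, hpe⟩ := hα v
  obtain ⟨q, hq, hqe⟩ := hβ v
  refine ⟨p - q, ?_, fun x => by simp [hpe, hqe]⟩
  intro d hd
  rcases Finset.mem_union.1 (MvPolynomial.support_sub _ p q hd) with h | h
  exacts [hp d h, hq d h]

/-- Forms with polynomial coefficients come from a polynomial-valued alternating map. -/
lemma exists_polyForm {m k : ℕ} {r : ℤ} {α : Form m k} (hα : α ∈ PL m k r) :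
    ∃ A : Vec m [⋀^Fin k]→ₗ[ℝ] MvPolynomial (Fin m) ℝ,
      (∀ v, degLE r (A v)) ∧ ∀ x v, α x v = MvPolynomial.eval x (A v) := by
  choose p hp hpe using hα
  refine ⟨{ toFun := p, map_update_add' := ?_, map_update_smul' := ?_,
            map_eq_zero_of_eq' := ?_ }, hp, fun x v => hpe v x⟩
  · intro _ v i a b
    refine MvPolynomial.funext fun x => ?_
    rw [map_add, ← hpe, ← hpe, ← hpe]
    convert (α x).map_update_add v i a b
  · intro _ v i c a
    refine MvPolynomial.funext fun x => ?_
    rw [MvPolynomial.smul_eval, ← hpe, ← hpe]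
    convert (α x).map_update_smul v i c a using 1
    rfl
  · intro v i j h hij
    refine MvPolynomial.funext fun x => ?_
    rw [map_zero, ← hpe]
    exact (α x).map_eq_zero_of_eq v h hij

/-- The sign of the reflection `R_i` on the `j`-th coordinate. -/
def reflSign {m : ℕ} (i j : Fin m) : ℝ := if j = i then -1 else 1

lemma reflSign_mul_self {m : ℕ} (i j : Fin m) : reflSign i j * reflSign i j = 1 := by
  unfold reflSign; split <;> simp

lemma reflFun_apply {m : ℕ} (i j : Fin m) (u : Vec m) :
    reflFun m i u j = reflSign i j * u j := by
  unfold reflFun reflSign; split <;> simp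

lemma reflLin_eq {m : ℕ} (i : Fin m) (u : Vec m) : reflLin m i u = reflFun m i u := by
  ext j
  by_cases h : j = i <;> simp [reflLin, reflFun, h]

lemma reflLin_apply {m : ℕ} (i j : Fin m) (u : Vec m) :
    reflLin m i u j = reflSign i j * u j := by
  rw [reflLin_eq, reflFun_apply]

lemma reflLin_single {m : ℕ} (i j : Fin m) :
    reflLin m i (Pi.single j 1) = reflSign i j • Pi.single j 1 := by
  ext a
  rw [reflLin_apply]
  by_cases h : a = j
  · subst h; simp
  · simp [h]

lemma reflFun_reflFun {m : ℕ} (i : Fin m) (u : Vec m) : reflFun m i (reflFun m i u) = u := by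
  ext j
  rw [reflFun_apply, reflFun_apply, ← mul_assoc, reflSign_mul_self, one_mul]

lemma reflLin_reflLin {m : ℕ} (i : Fin m) (u : Vec m) : reflLin m i (reflLin m i u) = u := by
  rw [reflLin_eq, reflLin_eq, reflFun_reflFun]

lemma map_reflLin_stdTuple {m k : ℕ} (i : Fin m) (f : Vec m [⋀^Fin k]→ₗ[ℝ] ℝ)
    (t : Fin k → Fin m) :
    f (fun a => reflLin m i (stdTuple t a)) = (∏ a, reflSign i (t a)) * f (stdTuple t) := by
  simp only [stdTuple, reflLin_single]
  exact f.map_smul_univ _ _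

/-- Substitution of the reflection `R_i` into polynomials. -/
def reflPoly {m : ℕ} (i : Fin m) (p : MvPolynomial (Fin m) ℝ) : MvPolynomial (Fin m) ℝ :=
  MvPolynomial.aeval (fun j => MvPolynomial.C (reflSign i j) * MvPolynomial.X j) p

lemma eval_reflPoly {m : ℕ} (i : Fin m) (p : MvPolynomial (Fin m) ℝ) (x : Vec m) :
    MvPolynomial.eval x (reflPoly i p) = MvPolynomial.eval (reflFun m i x) p := by
  induction p using MvPolynomial.induction_on with
  | C a => simp [reflPoly]
  | add p q hp hq => simp_all [reflPoly]
  | mul_X p j hp =>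
    simp only [reflPoly, map_mul, MvPolynomial.aeval_X] at hp ⊢
    rw [hp]
    simp [reflFun_apply]

lemma coeff_reflPoly {m : ℕ} (i : Fin m) (p : MvPolynomial (Fin m) ℝ) (d : Fin m →₀ ℕ) :
    MvPolynomial.coeff d (reflPoly i p) = (-1) ^ d i * MvPolynomial.coeff d p := by
  induction p using MvPolynomial.induction_on' with
  | add p q hp hq =>
    simp only [reflPoly, map_add, MvPolynomial.coeff_add] at hp hq ⊢
    rw [hp, hq, mul_add]
  | monomial e a =>
    have h : reflPoly i (MvPolynomial.monomial e a)
        = MvPolynomial.monomial e ((-1) ^ e i * a) := by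
      refine MvPolynomial.funext fun x => ?_
      rw [eval_reflPoly, MvPolynomial.eval_monomial, MvPolynomial.eval_monomial,
        Finsupp.prod_fintype _ _ (by simp), Finsupp.prod_fintype _ _ (by simp)]
      simp only [reflFun_apply, mul_pow, Finset.prod_mul_distrib]
      have : ∏ j, reflSign i j ^ e j = (-1 : ℝ) ^ e i := by
        rw [Finset.prod_eq_single i]
        · simp [reflSign]
        · intro j _ hj; simp [reflSign, hj]
        · simp
      rw [this]; ring
    rw [h, MvPolynomial.coeff_monomial, MvPolynomial.coeff_monomial]
    split
    · next h => rw [h]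
    · simp

lemma degLE_reflPoly {m : ℕ} {r : ℤ} (i : Fin m) {p : MvPolynomial (Fin m) ℝ}
    (h : degLE r p) : degLE r (reflPoly i p) := by
  intro d hd
  rw [MvPolynomial.mem_support_iff, coeff_reflPoly] at hd
  exact h d (MvPolynomial.mem_support_iff.2 (right_ne_zero_of_mul hd))

lemma PL_reflPull {m k : ℕ} {r : ℤ} (i : Fin m) {α : Form m k} (hα : α ∈ PL m k r) :
    reflPull m k i α ∈ PL m k r := by
  intro v
  obtain ⟨p, hp, hpe⟩ := hα fun a => reflLin m i (v a)
  exact ⟨reflPoly i p, degLE_reflPoly i hp, fun x => by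
    rw [eval_reflPoly, ← hpe]; rfl⟩

lemma contrMany_apply {m : ℕ} (k : ℕ) (v : Fin k → Vec m) {j : ℕ}
    (f : Vec m [⋀^Fin (k + j)]→ₗ[ℝ] ℝ) (w : Fin j → Vec m) :
    contrMany k v f w = f (Fin.append v w) := by
  induction k with
  | zero =>
    simp only [contrMany, AlternatingMap.domDomCongr_apply]
    congr 1
    rw [Subsingleton.elim v Fin.elim0, Fin.elim0_append]
    rfl
  | succ k ih =>
    simp only [contrMany]
    rw [ih, AlternatingMap.curryLeft_apply_apply, AlternatingMap.domDomCongr_apply]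
    congr 1
    conv_rhs => rw [← Fin.cons_self_tail v, Fin.append_cons]
    rfl

/-- The Hodge star with the target degree `l` given by `j + l = m`. -/
def hodge {m j l : ℕ} (h : j + l = m) :
    (Vec m [⋀^Fin j]→ₗ[ℝ] ℝ) →ₗ[ℝ] (Vec m [⋀^Fin l]→ₗ[ℝ] ℝ) where
  toFun α := (starAlt m j α).domDomCongr (finCongr (by omega))
  map_add' α β := by
    ext v
    simp [starAlt, show j ≤ m by omega, add_smul, Finset.sum_add_distrib]
  map_smul' c α := by
    ext v
    simp [starAlt, show j ≤ m by omega, mul_smul, ← Finset.smul_sum]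
    ring

lemma hodge_apply {m j l : ℕ} (h : j + l = m) (α : Vec m [⋀^Fin j]→ₗ[ℝ] ℝ)
    (w : Fin l → Vec m) :
    hodge h α w = (j.factorial : ℝ)⁻¹ * ∑ g : Fin j → Fin m,
      α (stdTuple g) * volForm m (Fin.append (stdTuple g) w ∘ Fin.cast h.symm) := by
  obtain rfl : l = m - j := by omega
  change evalAt _ (starAlt m j α) = _
  simp only [starAlt, dif_pos (show j ≤ m by omega), map_smul, map_sum, smul_eq_mul]
  congr 1
  refine Finset.sum_congr rfl fun g _ => ?_
  change _ * contrMany j _ _ _ = _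
  rw [contrMany_apply]
  rfl

lemma volForm_reflLin {m : ℕ} (i : Fin m) (v : Fin m → Vec m) :
    volForm m (fun a => reflLin m i (v a)) = - volForm m v := by
  have h : LinearMap.det (reflLin m i) = -1 := by
    have : reflLin m i = Matrix.toLin' (Matrix.diagonal (reflSign i)) := by
      ext v j
      by_cases hj : j = v <;> simp [reflLin_apply, hj]
    rw [this, LinearMap.det_toLin', Matrix.det_diagonal]
    simp [reflSign, Finset.prod_ite_eq']
  have := (Pi.basisFun ℝ (Fin m)).det_comp (reflLin m i) v
  rw [h] at this
  simpa [volForm, Function.comp_def] using this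

lemma hodge_compLinearMap_reflLin {m j l : ℕ} (h : j + l = m) (i : Fin m)
    (α : Vec m [⋀^Fin j]→ₗ[ℝ] ℝ) :
    hodge h (α.compLinearMap (reflLin m i)) = -(hodge h α).compLinearMap (reflLin m i) := by
  ext w
  rw [AlternatingMap.neg_apply, AlternatingMap.compLinearMap_apply, hodge_apply, hodge_apply,
    ← mul_neg, ← Finset.sum_neg_distrib]
  congr 1
  refine Finset.sum_congr rfl fun g _ => ?_
  rw [AlternatingMap.compLinearMap_apply]
  have h1 := map_reflLin_stdTuple i α g
  have h2 := volForm_reflLin i (Fin.append (stdTuple g) w ∘ Fin.cast h.symm)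
  set ε := ∏ a, reflSign i (g a) with hε
  have hεε : ε * ε = 1 := by
    rw [hε, ← Finset.prod_mul_distrib]; simp [reflSign_mul_self]
  have h3 : volForm m (fun a => reflLin m i ((Fin.append (stdTuple g) w ∘ Fin.cast h.symm) a))
      = ε * volForm m (Fin.append (stdTuple g) (reflLin m i ∘ w) ∘ Fin.cast h.symm) := by
    subst h
    have := (volForm (j + l)).map_smul_univ
      (Fin.append (fun a => reflSign i (g a)) (fun _ => 1))
      (Fin.append (stdTuple g) (reflLin (j + l) i ∘ w))
    rw [Fin.prod_univ_add] at this
    simp only [Fin.append_left, Fin.append_right, Finset.prod_const_one, mul_one] at this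
    rw [smul_eq_mul] at this
    rw [hε]
    refine Eq.trans (congrArg _ ?_) this
    funext a
    refine Fin.addCases (fun b => ?_) (fun b => ?_) a
    · simp [stdTuple, reflLin_single]
    · simp
  change α (fun a => reflLin m i (stdTuple g a)) * _ = -(_ * volForm m (Fin.append (stdTuple g)
    (reflLin m i ∘ w) ∘ Fin.cast h.symm))
  rw [h1]
  rw [h3] at h2
  linear_combination (α (stdTuple g) * ε) * h2 - (α (stdTuple g) * volForm m
    (Fin.append (stdTuple g) (reflLin m i ∘ w) ∘ Fin.cast h.symm)) * hεε

lemma map_sumElim_perm {ι κ : Type*} [Fintype ι] [Fintype κ] [DecidableEq ι] [DecidableEq κ]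
    {m : ℕ} (f : Vec m [⋀^ι ⊕ κ]→ₗ[ℝ] ℝ) (σ : Equiv.Perm ι) (v : ι → Vec m) (w : κ → Vec m) :
    f (Sum.elim (v ∘ σ) w) = Equiv.Perm.sign σ • f (Sum.elim v w) := by
  have h := f.map_perm (Sum.elim v w) (Equiv.Perm.sumCongr σ 1)
  rw [Equiv.Perm.sign_sumCongr, Equiv.Perm.sign_one, mul_one] at h
  rw [← h]
  congr 1
  funext x
  cases x <;> rfl

/-- The equivalence splitting `Fin m` into its first `j` and last `l` elements. -/
def splitEquiv {m j l : ℕ} (h : j + l = m) : Fin m ≃ Fin j ⊕ Fin l :=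
  (finCongr h.symm).trans finSumFinEquiv.symm

lemma append_cast_eq {m j l : ℕ} (h : j + l = m) {X : Type*} (v : Fin j → X) (w : Fin l → X) :
    Fin.append v w ∘ Fin.cast h.symm = Sum.elim v w ∘ splitEquiv h := by
  subst h
  funext x
  refine Fin.addCases (fun b => ?_) (fun b => ?_) x <;> simp [splitEquiv]

lemma map_append_perm {m j l : ℕ} (h : j + l = m) (f : Vec m [⋀^Fin m]→ₗ[ℝ] ℝ)
    (σ : Equiv.Perm (Fin j)) (v : Fin j → Vec m) (w : Fin l → Vec m) :
    f (Fin.append (v ∘ σ) w ∘ Fin.cast h.symm)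
      = Equiv.Perm.sign σ • f (Fin.append v w ∘ Fin.cast h.symm) := by
  rw [append_cast_eq h, append_cast_eq h]
  exact map_sumElim_perm (f.domDomCongr (splitEquiv h)) σ v w

lemma map_stdTuple_of_not_injective {m k : ℕ} (f : Vec m [⋀^Fin k]→ₗ[ℝ] ℝ) {g : Fin k → Fin m}
    (hg : ¬ Function.Injective g) : f (stdTuple g) = 0 := by
  simp only [Function.Injective, not_forall] at hg
  obtain ⟨a, b, hab, hne⟩ := hg
  exact f.map_eq_zero_of_eq _ (by simp [stdTuple, hab]) hne

lemma volForm_stdTuple_ne_zero {m : ℕ} {g : Fin m → Fin m} (hg : Function.Injective g) :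
    volForm m (stdTuple g) ≠ 0 := by
  let σ : Equiv.Perm (Fin m) := Equiv.ofBijective g (Finite.injective_iff_bijective.1 hg)
  have h : stdTuple g = (Pi.basisFun ℝ (Fin m)) ∘ σ := by
    funext a; simp [stdTuple, σ]
  rw [h, volForm, AlternatingMap.map_perm, Module.Basis.det_self]
  rcases Int.units_eq_one_or (Equiv.Perm.sign σ) with h | h <;> simp [h]

lemma append_stdTuple {m j l : ℕ} (h : j + l = m) (g : Fin j → Fin m) (s : Fin l → Fin m) :
    Fin.append (stdTuple g) (stdTuple s) ∘ Fin.cast h.symm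
      = stdTuple (Fin.append g s ∘ Fin.cast h.symm) := by
  rw [append_cast_eq h, append_cast_eq h]
  funext x
  simp only [stdTuple, Function.comp_apply]
  cases splitEquiv h x <;> rfl

lemma hodge_injective {m j l : ℕ} (h : j + l = m) :
    Function.Injective (hodge h : (Vec m [⋀^Fin j]→ₗ[ℝ] ℝ) →ₗ[ℝ] _) := by
  classical
  rw [injective_iff_map_eq_zero]
  intro α hα
  refine alternating_ext_stdTuple fun t => ?_
  by_cases ht : Function.Injective t
  swap
  · rw [map_stdTuple_of_not_injective _ ht, map_stdTuple_of_not_injective _ ht]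
  have hcard : Fintype.card {x // x ∉ Set.range t} = l := by
    rw [Fintype.card_subtype_compl, Fintype.card_fin, Set.card_range_of_injective ht,
      Fintype.card_fin]
    omega
  let e : Fin l ≃ {x // x ∉ Set.range t} := (Fintype.equivFinOfCardEq hcard).symm
  let s : Fin l → Fin m := fun a => (e a).1
  have hs : ∀ x, x ∉ Set.range s → x ∈ Set.range t := by
    intro x hx
    by_contra hx'
    exact hx ⟨e.symm ⟨x, hx'⟩, by simp [s]⟩
  have hinj : ∀ g : Fin j → Fin m, Function.Injective (Fin.append g s ∘ Fin.cast h.symm) ↔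
      Function.Injective g ∧ Function.Injective s ∧ ∀ a b, g a ≠ s b := by
    intro g
    rw [← Fin.append_injective_iff]
    exact Function.Injective.of_comp_iff' _ (finCongr h.symm).bijective
  have h0 := congrArg (fun f => f (stdTuple s)) hα
  simp only [hodge_apply, AlternatingMap.zero_apply] at h0
  set a := α (stdTuple t) * volForm m (Fin.append (stdTuple t) (stdTuple s) ∘ Fin.cast h.symm)
  have hterm : ∀ g : Fin j → Fin m,
      α (stdTuple g) * volForm m (Fin.append (stdTuple g) (stdTuple s) ∘ Fin.cast h.symm)
        = if Function.Injective (Fin.append g s ∘ Fin.cast h.symm) then a else 0 := by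
    intro g
    split_ifs with hg
    · obtain ⟨h1, h2, h3⟩ := (hinj g).1 hg
      have : ∀ a, ∃ b, t b = g a := fun a => hs _ (by rintro ⟨b, hb⟩; exact h3 a b hb.symm)
      choose σ hσ using this
      have hσi : Function.Injective σ := fun x y hxy => h1 (by rw [← hσ, ← hσ, hxy])
      let τ : Equiv.Perm (Fin j) := Equiv.ofBijective σ (Finite.injective_iff_bijective.1 hσi)
      have hgt : stdTuple g = stdTuple t ∘ τ := by
        funext x; simp [stdTuple, τ, hσ]
      rw [hgt, map_append_perm h, AlternatingMap.map_perm]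
      rcases Int.units_eq_one_or (Equiv.Perm.sign τ) with h | h <;> simp [h, a]
    · rw [append_stdTuple h, map_stdTuple_of_not_injective _ hg, mul_zero]
  have htinj : Function.Injective (Fin.append t s ∘ Fin.cast h.symm) :=
    (hinj t).2 ⟨ht, fun x y hxy => e.injective (Subtype.ext hxy),
      fun x y hxy => (e y).2 ⟨x, hxy⟩⟩
  simp only [hterm, Finset.sum_ite, Finset.sum_const_zero, add_zero, Finset.sum_const,
    nsmul_eq_mul, mul_eq_zero, inv_eq_zero, Nat.cast_eq_zero] at h0
  rcases h0 with h0 | h0 | h0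
  · exact absurd h0 (Nat.factorial_ne_zero _)
  · rw [Finset.card_eq_zero, Finset.filter_eq_empty_iff] at h0
    exact absurd htinj (h0 (Finset.mem_univ t))
  · rcases mul_eq_zero.1 h0 with h0 | h0
    · simpa using h0
    · rw [append_stdTuple h] at h0
      exact absurd h0 (volForm_stdTuple_ne_zero htinj)

/-- The Hodge star as a linear equivalence. -/
def hodgeEquiv {m j l : ℕ} (h : j + l = m) :
    (Vec m [⋀^Fin j]→ₗ[ℝ] ℝ) ≃ₗ[ℝ] (Vec m [⋀^Fin l]→ₗ[ℝ] ℝ) :=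
  (hodge h).linearEquivOfInjective (hodge_injective h) <|
    le_antisymm (LinearMap.finrank_le_finrank_of_injective (hodge_injective h))
      (LinearMap.finrank_le_finrank_of_injective
        (hodge_injective (show l + j = m by omega)))

lemma wedgeAlt_apply {m k l : ℕ} (α : Vec m [⋀^Fin k]→ₗ[ℝ] ℝ) (β : Vec m [⋀^Fin l]→ₗ[ℝ] ℝ)
    (v : Fin k ⊕ Fin l → Vec m) :
    ((k.factorial * l.factorial : ℕ) : ℝ) * wedgeAlt α β (v ∘ finSumFinEquiv.symm) =
      ∑ σ : Equiv.Perm (Fin k ⊕ Fin l), (Equiv.Perm.sign σ : ℤ) *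
        (α (v ∘ σ ∘ Sum.inl) * β (v ∘ σ ∘ Sum.inr)) := by
  have h := congrArg (fun f => TensorProduct.lid ℝ ℝ (f v))
    (MultilinearMap.domCoprod_alternization_eq α β)
  simp only [MultilinearMap.alternatization_apply, map_sum, Fintype.card_fin,
    AlternatingMap.smul_apply, map_nsmul] at h
  rw [nsmul_eq_mul] at h
  have h2 : wedgeAlt α β (v ∘ finSumFinEquiv.symm)
      = TensorProduct.lid ℝ ℝ (α.domCoprod β v) := by
    simp [wedgeAlt, Function.comp_def]
  rw [h2, ← h]
  refine Finset.sum_congr rfl fun σ _ => ?_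
  rcases Int.units_eq_one_or (Equiv.Perm.sign σ) with hs | hs <;>
    simp [hs, Function.comp_def]

/-- Contraction of a wedge product against an alternating tensor, summed over all basis tuples. -/
lemma sum_wedgeAlt_mul {m k l q : ℕ} (h : (k + l) + q = m) (α : Vec m [⋀^Fin k]→ₗ[ℝ] ℝ)
    (β : Vec m [⋀^Fin l]→ₗ[ℝ] ℝ) (f : Vec m [⋀^Fin m]→ₗ[ℝ] ℝ) (w : Fin q → Vec m) :
    ((k.factorial * l.factorial : ℕ) : ℝ) * ∑ g : Fin (k + l) → Fin m,
        wedgeAlt α β (stdTuple g) * f (Fin.append (stdTuple g) w ∘ Fin.cast h.symm) =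
      ((k + l).factorial : ℝ) * ∑ a : Fin k → Fin m, ∑ b : Fin l → Fin m,
        α (stdTuple a) * β (stdTuple b) *
          f (Fin.append (Fin.append (stdTuple a) (stdTuple b)) w ∘ Fin.cast h.symm) := by
  classical
  let B : (Fin k ⊕ Fin l → Fin m) → Fin k ⊕ Fin l → Vec m := fun g x => Pi.single (g x) 1
  let F : (Fin k ⊕ Fin l → Vec m) → ℝ := fun v =>
    f (Fin.append (v ∘ finSumFinEquiv.symm) w ∘ Fin.cast h.symm)
  let T : (Fin k ⊕ Fin l → Vec m) → ℝ := fun v => α (v ∘ Sum.inl) * β (v ∘ Sum.inr)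
  have hF : ∀ v (σ : Equiv.Perm (Fin k ⊕ Fin l)),
      F (v ∘ σ) = (Equiv.Perm.sign σ : ℤ) * F v := by
    intro v σ
    have := map_append_perm h f (finSumFinEquiv.permCongr σ) (v ∘ finSumFinEquiv.symm) w
    rw [Equiv.Perm.sign_permCongr] at this
    have h2 : (v ∘ finSumFinEquiv.symm) ∘ (finSumFinEquiv.permCongr σ)
        = (v ∘ σ) ∘ finSumFinEquiv.symm := by
      funext x; simp [Equiv.permCongr_apply]
    rw [h2] at this
    change f _ = _ * f _
    rw [this]
    rcases Int.units_eq_one_or (Equiv.Perm.sign σ) with hs | hs <;> simp [hs]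
  have hL : ∑ g : Fin (k + l) → Fin m,
        wedgeAlt α β (stdTuple g) * f (Fin.append (stdTuple g) w ∘ Fin.cast h.symm)
      = ∑ g : Fin k ⊕ Fin l → Fin m, wedgeAlt α β (B g ∘ finSumFinEquiv.symm) * F (B g) :=
    Fintype.sum_equiv (Equiv.arrowCongr finSumFinEquiv.symm (Equiv.refl _)) _ _ fun g => by
      have : B (Equiv.arrowCongr finSumFinEquiv.symm (Equiv.refl _) g) ∘ finSumFinEquiv.symm
          = stdTuple g := by
        funext x; simp [B, stdTuple]
      simp only [F, this]
  have hR : ∑ a : Fin k → Fin m, ∑ b : Fin l → Fin m,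
        α (stdTuple a) * β (stdTuple b) *
          f (Fin.append (Fin.append (stdTuple a) (stdTuple b)) w ∘ Fin.cast h.symm)
      = ∑ g : Fin k ⊕ Fin l → Fin m, T (B g) * F (B g) := by
    rw [← Fintype.sum_prod_type']
    refine (Fintype.sum_equiv (Equiv.sumArrowEquivProdArrow _ _ _) _ _ fun g => ?_).symm
    have : Fin.append (stdTuple (g ∘ Sum.inl)) (stdTuple (g ∘ Sum.inr))
        = B g ∘ finSumFinEquiv.symm := by
      funext x
      refine Fin.addCases (fun b => ?_) (fun b => ?_) x <;> simp [B, stdTuple]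
    simp only [Equiv.sumArrowEquivProdArrow, Equiv.coe_fn_mk, this]
    rfl
  rw [hL, hR, Finset.mul_sum]
  have hterm : ∀ g : Fin k ⊕ Fin l → Fin m,
      ((k.factorial * l.factorial : ℕ) : ℝ) *
        (wedgeAlt α β (B g ∘ finSumFinEquiv.symm) * F (B g))
      = ∑ σ : Equiv.Perm (Fin k ⊕ Fin l), T (B (g ∘ σ)) * F (B (g ∘ σ)) := by
    intro g
    rw [← mul_assoc, wedgeAlt_apply, Finset.sum_mul]
    refine Finset.sum_congr rfl fun σ _ => ?_
    change _ = T (B g ∘ σ) * F (B g ∘ σ)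
    rw [hF]
    simp only [T, Function.comp_assoc]
    ring
  rw [Finset.sum_congr rfl fun g _ => hterm g, Finset.sum_comm]
  have hσ : ∀ σ : Equiv.Perm (Fin k ⊕ Fin l),
      ∑ g : Fin k ⊕ Fin l → Fin m, T (B (g ∘ σ)) * F (B (g ∘ σ))
        = ∑ g : Fin k ⊕ Fin l → Fin m, T (B g) * F (B g) := fun σ =>
    Fintype.sum_equiv (Equiv.arrowCongr σ.symm (Equiv.refl _)) _ _ fun g => by
      have : Equiv.arrowCongr σ.symm (Equiv.refl (Fin m)) g = g ∘ σ := by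
        funext x; simp
      rw [this]
  rw [Finset.sum_congr rfl fun σ _ => hσ σ, Finset.sum_const, Finset.card_univ,
    Fintype.card_perm, Fintype.card_sum, Fintype.card_fin, Fintype.card_fin, nsmul_eq_mul]

lemma map_append_vecCons {j l : ℕ} (f : Vec (j + (l + 1)) [⋀^Fin (j + (l + 1))]→ₗ[ℝ] ℝ)
    (v : Fin j → Vec (j + (l + 1))) (u : Vec (j + (l + 1))) (w : Fin l → Vec (j + (l + 1))) :
    f (Fin.append v (Matrix.vecCons u w))
      = (-1) ^ j * AlternatingMap.curryLeft (n := j + l) f u (Fin.append v w) := by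
  rw [AlternatingMap.curryLeft_apply_apply]
  have h : f (Fin.insertNth (n := j + l) ⟨j, by omega⟩ u (Fin.append v w))
      = (-1) ^ j * f (Matrix.vecCons u (Fin.append v w)) := by
    rw [AlternatingMap.map_insertNth (n := j + l)]
    simp
  refine Eq.trans (congrArg f ?_) h
  have e1 : (⟨j, by omega⟩ : Fin (j + l + 1)) = Fin.natAdd j (0 : Fin (l + 1)) := rfl
  refine (Fin.eq_insertNth_iff (n := j + l)).2 ⟨?_, ?_⟩
  · rw [e1]
    exact Fin.append_right _ _ _
  · funext x
    rw [Fin.removeNth_apply]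
    refine Fin.addCases (fun b => ?_) (fun b => ?_) x
    · rw [Fin.append_left, Fin.succAbove_of_castSucc_lt _ _ (by simp [Fin.lt_def])]
      exact Fin.append_left v (Matrix.vecCons u w) b
    · rw [Fin.append_right, Fin.succAbove_of_le_castSucc _ _ (by simp [Fin.le_def])]
      exact Fin.append_right v (Matrix.vecCons u w) b.succ

lemma dotLin_apply {m : ℕ} (u v : Vec m) : dotLin m u v = ∑ i, u i * v i := by
  simp [dotLin]

lemma hodge_nuForm_wedge {m j l : ℕ} (h : j + (l + 1) = m) (h' : 1 + j + l = m) (u : Vec m)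
    (α : Vec m [⋀^Fin j]→ₗ[ℝ] ℝ) :
    hodge h' (wedgeAlt (nuForm m u) α) = (-1 : ℝ) ^ j • (hodge h α).curryLeft u := by
  subst h
  ext w
  have h1 := sum_wedgeAlt_mul h' (nuForm _ u) α (volForm _) w
  rw [AlternatingMap.smul_apply, AlternatingMap.curryLeft_apply_apply, hodge_apply, hodge_apply]
  rw [Nat.factorial_one, one_mul] at h1
  have hj : ((1 + j).factorial : ℝ) ≠ 0 := Nat.cast_ne_zero.2 (Nat.factorial_ne_zero _)
  have hj' : (j.factorial : ℝ) ≠ 0 := Nat.cast_ne_zero.2 (Nat.factorial_ne_zero _)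
  have h2 : ∑ a : Fin 1 → Fin (j + (l + 1)), ∑ b : Fin j → Fin (j + (l + 1)),
        nuForm _ u (stdTuple a) * α (stdTuple b) *
          volForm _ (Fin.append (Fin.append (stdTuple a) (stdTuple b)) w ∘ Fin.cast h'.symm)
      = (-1) ^ j * ∑ g : Fin j → Fin (j + (l + 1)), α (stdTuple g) *
        volForm _ (Fin.append (stdTuple g) (Matrix.vecCons u w)) := by
    rw [Finset.sum_comm, Finset.mul_sum]
    refine Finset.sum_congr rfl fun b _ => ?_
    rw [map_append_vecCons]
    conv_rhs => rw [vec_eq_sum u]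
    rw [← Fintype.sum_equiv (Equiv.funUnique (Fin 1) (Fin (j + (l + 1)))).symm
      (fun a => u a * α (stdTuple b) * AlternatingMap.curryLeft (n := j + l) (volForm _)
        (Pi.single a 1) (Fin.append (stdTuple b) w)) _ fun a => ?_]
    · change _ = (-1) ^ j * (α _ * ((-1) ^ j * evalAt _
        (AlternatingMap.curryLeft (n := j + l) (volForm _) _)))
      rw [map_sum, map_sum]
      simp only [map_smul, smul_eq_mul, Finset.mul_sum]
      refine Finset.sum_congr rfl fun a _ => ?_
      have : ((-1 : ℝ) ^ j) * (-1) ^ j = 1 := by rw [← mul_pow]; simp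
      simp only [evalAt, LinearMap.coe_mk, AddHom.coe_mk]
      linear_combination (-(α (stdTuple b) * u a * AlternatingMap.curryLeft (n := j + l)
        (volForm _) (Pi.single a 1) (Fin.append (stdTuple b) w))) * this
    · congr 1
      · simp [nuForm, dotLin_apply, stdTuple, Pi.single_apply]
      · rw [AlternatingMap.curryLeft_apply_apply, Fin.append_left_eq_cons]
        congr 1
        rw [Fin.append_cast_left, Fin.append_cons]
        funext x
        rfl
  rw [h2] at h1
  have h3 : ∀ g : Fin j → Fin (j + (l + 1)),
    (Fin.append (stdTuple g) (Matrix.vecCons u w) ∘ Fin.cast rfl)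
      = Fin.append (stdTuple g) (Matrix.vecCons u w) := fun _ => rfl
  simp only [h3, smul_eq_mul]
  field_simp
  linear_combination h1

/-- The linear map on polynomials sending `x ^ d` to `x ^ ⌊d / 2⌋`. -/
def halfPoly (m : ℕ) : MvPolynomial (Fin m) ℝ →ₗ[ℝ] MvPolynomial (Fin m) ℝ :=
  (MvPolynomial.basisMonomials (Fin m) ℝ).constr ℝ
    fun d => MvPolynomial.monomial (d.mapRange (· / 2) rfl) 1

lemma halfPoly_eq_sum {m : ℕ} (p : MvPolynomial (Fin m) ℝ) :
    halfPoly m p = ∑ d ∈ p.support,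
      p.coeff d • MvPolynomial.monomial (d.mapRange (· / 2) rfl) (1 : ℝ) := by
  conv_lhs => rw [p.as_sum]
  rw [map_sum]
  refine Finset.sum_congr rfl fun d _ => ?_
  have h : MvPolynomial.monomial d (p.coeff d)
      = p.coeff d • MvPolynomial.basisMonomials (Fin m) ℝ d := by
    simp [MvPolynomial.smul_monomial]
  rw [h, map_smul, halfPoly, Module.Basis.constr_basis]

lemma dPhi_apply {m : ℕ} (u v : Vec m) (i : Fin m) : dPhi m u v i = 2 * u i * v i := by
  simp [dPhi]

lemma phiPull_stdTuple {m k : ℕ} (β : Form m k) (u : Vec m) (t : Fin k → Fin m) :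
    phiPull m k β u (stdTuple t) = (∏ a, 2 * u (t a)) * β (Phi m u) (stdTuple t) := by
  have h : ∀ a, dPhi m u (stdTuple t a) = (2 * u (t a)) • stdTuple t a := by
    intro a
    ext i
    rw [dPhi_apply]
    by_cases hi : i = t a
    · subst hi; simp [stdTuple]
    · simp [stdTuple, hi]
  change β (Phi m u) (fun a => dPhi m u (stdTuple t a)) = _
  simp only [h]
  exact (β (Phi m u)).map_smul_univ _ _

lemma Phi_reflFun {m : ℕ} (i : Fin m) (u : Vec m) : Phi m (reflFun m i u) = Phi m u := by
  ext j
  have := reflSign_mul_self i j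
  simp only [Phi, reflFun_apply]
  linear_combination u j ^ 2 * this

lemma isEven_phiPull {m k : ℕ} (β : Form m k) : IsEven m k (phiPull m k β) := by
  intro i
  funext u
  ext v
  change β (Phi m (reflFun m i u)) (fun a => dPhi m (reflFun m i u) (reflLin m i (v a)))
    = β (Phi m u) (fun a => dPhi m u (v a))
  rw [Phi_reflFun]
  congr 1
  funext a
  ext j
  have := reflSign_mul_self i j
  rw [dPhi_apply, dPhi_apply, reflFun_apply, reflLin_apply]
  linear_combination (2 * u j * v a j) * this

lemma degLE_iff_totalDegree {m N : ℕ} {p : MvPolynomial (Fin m) ℝ} :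
    degLE (N : ℤ) p ↔ p.totalDegree ≤ N := by
  rw [MvPolynomial.totalDegree, Finset.sup_le_iff]
  exact forall₂_congr fun d _ => Nat.cast_le

lemma phiPull_mem_PL {m k s : ℕ} {β : Form m k} (hβ : β ∈ PL m k s) :
    phiPull m k β ∈ PL m k (2 * s + k : ℕ) := by
  refine mem_PL_of_stdTuple fun t => ?_
  obtain ⟨p, hp, hpe⟩ := hβ (stdTuple t)
  rw [degLE_iff_totalDegree] at hp
  refine ⟨(∏ a, MvPolynomial.C 2 * MvPolynomial.X (t a)) * MvPolynomial.expand 2 p,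
    degLE_iff_totalDegree.2 ?_, fun u => ?_⟩
  · refine (MvPolynomial.totalDegree_mul _ _).trans ?_
    rw [MvPolynomial.totalDegree_expand, add_comm]
    refine add_le_add (by omega) ?_
    refine (MvPolynomial.totalDegree_finsetProd _ _).trans ?_
    refine (Finset.sum_le_card_nsmul _ _ 1 fun a _ => ?_).trans (by simp)
    exact (MvPolynomial.totalDegree_mul _ _).trans (by simp)
  · rw [phiPull_stdTuple, hpe, map_mul, map_prod]
    congr 1
    · simp
    · exact (MvPolynomial.eval_expand 2 u p).symm

/-- Parity of the exponents in the coefficients of an even polynomial form. -/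
lemma parity_of_isEven {m k : ℕ} {γ : Form m k} (hγ : IsEven m k γ)
    {A : Vec m [⋀^Fin k]→ₗ[ℝ] MvPolynomial (Fin m) ℝ}
    (hA : ∀ x v, γ x v = MvPolynomial.eval x (A v)) {t : Fin k → Fin m}
    (ht : Function.Injective t) {d : Fin m →₀ ℕ} (hd : d ∈ (A (stdTuple t)).support)
    (i : Fin m) : d i % 2 = ∑ a, if t a = i then 1 else 0 := by
  have h1 : reflPoly i (A (stdTuple t)) = (∏ a, reflSign i (t a)) • A (stdTuple t) := by
    refine MvPolynomial.funext fun u => ?_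
    rw [eval_reflPoly, MvPolynomial.smul_eval, ← hA, ← hA]
    have h2 := congrArg (fun f => f (reflFun m i u) (stdTuple t)) (hγ i)
    simp only [reflPull, reflFun_reflFun] at h2
    rw [← h2]
    exact map_reflLin_stdTuple i (γ u) t
  have h3 := congrArg (MvPolynomial.coeff d) h1
  rw [coeff_reflPoly, MvPolynomial.coeff_smul, smul_eq_mul] at h3
  have h4 := mul_right_cancel₀ (MvPolynomial.mem_support_iff.1 hd) h3
  by_cases hi : ∃ a, t a = i
  · obtain ⟨a, rfl⟩ := hi
    rw [Finset.prod_eq_single a (fun b _ hb => by simp [reflSign, ht.ne hb]) (by simp)] at h4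
    rw [Finset.sum_eq_single a (fun b _ hb => by simp [ht.ne hb]) (by simp)]
    simp only [reflSign, if_true] at h4 ⊢
    rcases Nat.even_or_odd (d (t a)) with he | ho
    · rw [he.neg_one_pow] at h4; norm_num at h4
    · exact Nat.odd_iff.1 ho
  · simp only [not_exists] at hi
    simp only [reflSign, hi, if_false, Finset.prod_const_one, Finset.sum_const_zero] at h4 ⊢
    rcases Nat.even_or_odd (d i) with he | ho
    · exact Nat.even_iff.1 he
    · rw [ho.neg_one_pow] at h4; norm_num at h4

lemma exists_phiPull_eq {m k : ℕ} {s : ℤ} {γ : Form m k} (hγ : γ ∈ PL m k (2 * s + k))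
    (he : IsEven m k γ) : ∃ β ∈ PL m k s, phiPull m k β = γ := by
  obtain ⟨A, hdeg, hA⟩ := exists_polyForm hγ
  let β : Form m k := fun x => ((2 : ℝ) ^ k)⁻¹ •
    ((MvPolynomial.aeval x).toLinearMap ∘ₗ halfPoly m).compAlternatingMap A
  have hβ : ∀ x v, β x v = ((2 : ℝ) ^ k)⁻¹ * MvPolynomial.eval x (halfPoly m (A v)) := by
    intro x v
    simp [β, MvPolynomial.aeval_eq_eval]
  have hzero : ∀ t : Fin k → Fin m, ¬ Function.Injective t → A (stdTuple t) = 0 := by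
    intro t ht
    simp only [Function.Injective, not_forall] at ht
    obtain ⟨a, b, hab, hne⟩ := ht
    exact A.map_eq_zero_of_eq _ (by simp [stdTuple, hab]) hne
  refine ⟨β, mem_PL_of_stdTuple fun t => ⟨((2 : ℝ) ^ k)⁻¹ • halfPoly m (A (stdTuple t)), ?_,
    fun x => by rw [hβ, MvPolynomial.smul_eval]⟩, ?_⟩
  · by_cases ht : Function.Injective t
    swap
    · rw [hzero t ht]; simp [degLE]
    rw [halfPoly_eq_sum, Finset.smul_sum]
    simp only [smul_smul]
    refine degLE_sum_smul _ _ _ fun d hd e hee => ?_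
    have hle := hdeg _ d hd
    rw [MvPolynomial.support_monomial, if_neg one_ne_zero, Finset.mem_singleton] at hee
    subst hee
    rw [Finsupp.sum_fintype _ _ (by simp)] at hle ⊢
    have hpar := Finset.sum_congr rfl fun i (_ : i ∈ (Finset.univ : Finset (Fin m))) =>
      parity_of_isEven he hA ht hd i
    rw [Finset.sum_comm] at hpar
    simp only [Finset.sum_ite_eq, Finset.mem_univ, if_true, Finset.sum_const, Finset.card_univ,
      Fintype.card_fin, smul_eq_mul, mul_one] at hpar
    have hsum : ∑ i, d i = 2 * ∑ i, d i / 2 + ∑ i, d i % 2 := by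
      rw [Finset.mul_sum, ← Finset.sum_add_distrib]
      exact Finset.sum_congr rfl fun i _ => by omega
    simp only [Finsupp.mapRange_apply]
    rw [hsum, hpar] at hle
    push_cast at hle ⊢
    linarith
  · funext u
    refine alternating_ext_stdTuple fun t => ?_
    rw [phiPull_stdTuple, hβ, hA]
    by_cases ht : Function.Injective t
    swap
    · rw [hzero t ht]; simp
    conv_rhs => rw [MvPolynomial.eval_eq']
    rw [halfPoly_eq_sum, map_sum, Finset.prod_mul_distrib,
      Finset.prod_const, Finset.card_univ, Fintype.card_fin, mul_mul_mul_comm,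
      mul_inv_cancel₀ (by positivity), one_mul, Finset.mul_sum]
    refine Finset.sum_congr rfl fun d hd => ?_
    have h1 : ∏ a, u (t a) = ∏ i, u i ^ (d i % 2) := by
      simp only [parity_of_isEven he hA ht hd, ← Finset.prod_pow_eq_pow_sum]
      rw [Finset.prod_comm]
      exact Finset.prod_congr rfl fun a _ => by simp [pow_ite, Finset.prod_ite_eq]
    rw [h1, MvPolynomial.smul_eval, MvPolynomial.eval_monomial,
      Finsupp.prod_fintype _ _ (by simp), one_mul, mul_left_comm, ← Finset.prod_mul_distrib]
    congr 1
    refine Finset.prod_congr rfl fun i _ => ?_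
    rw [Phi, Finsupp.mapRange_apply, ← pow_mul, ← pow_add]
    congr 1
    omega

lemma exists_multilinearMap_append {m j l : ℕ} (f : Vec m [⋀^Fin (j + l)]→ₗ[ℝ] ℝ)
    (w : Fin l → Vec m) :
    ∃ F : MultilinearMap ℝ (fun _ : Fin j => Vec m) ℝ, ∀ v, F v = f (Fin.append v w) := by
  refine ⟨(⟨⟨fun G => G w, fun _ _ => rfl⟩, fun _ _ => rfl⟩ :
      MultilinearMap ℝ (fun _ : Fin l => Vec m) ℝ →ₗ[ℝ] ℝ).compMultilinearMap
    (f.toMultilinearMap.domDomCongr finSumFinEquiv.symm).currySum, fun v => ?_⟩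
  refine congrArg f (funext fun x => ?_)
  refine Fin.addCases (fun a => ?_) (fun a => ?_) x
  · rw [Fin.append_left, finSumFinEquiv_symm_apply_castAdd]
  · rw [Fin.append_right, finSumFinEquiv_symm_apply_natAdd]

/-- A symmetric linear map can be moved across the pairing of multilinear forms. -/
lemma sum_map_mul_of_symmetric {m j : ℕ} (F G : MultilinearMap ℝ (fun _ : Fin j => Vec m) ℝ)
    (P : Vec m →ₗ[ℝ] Vec m)
    (hP : ∀ a b, P (Pi.single a 1) b = P (Pi.single b 1) a) :
    ∑ g : Fin j → Fin m, F (fun i => P (stdTuple g i)) * G (stdTuple g)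
      = ∑ g : Fin j → Fin m, F (stdTuple g) * G (fun i => P (stdTuple g i)) := by
  have hF : ∀ g : Fin j → Fin m, F (fun i => P (stdTuple g i))
      = ∑ f : Fin j → Fin m, (∏ i, P (stdTuple g i) (f i)) * F (stdTuple f) :=
    fun g => multilinear_expand F _
  have hG : ∀ g : Fin j → Fin m, G (fun i => P (stdTuple g i))
      = ∑ f : Fin j → Fin m, (∏ i, P (stdTuple g i) (f i)) * G (stdTuple f) :=
    fun g => multilinear_expand G _
  simp only [hF, hG, Finset.sum_mul, Finset.mul_sum]
  rw [Finset.sum_comm]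
  refine Finset.sum_congr rfl fun f _ => Finset.sum_congr rfl fun g _ => ?_
  simp only [stdTuple, fun i => hP (g i) (f i)]
  ring

lemma curryLeft_add_smul {m k : ℕ} (f : Vec m [⋀^Fin (k + 1)]→ₗ[ℝ] ℝ) (u : Vec m)
    (v : Fin k → Vec m) (c : Fin k → ℝ) :
    f.curryLeft u (fun a => v a + c a • u) = f.curryLeft u v := by
  have h := (f.curryLeft u).toMultilinearMap.map_add_univ v fun a => c a • u
  rw [Finset.sum_eq_single Finset.univ ?_ (by simp)] at h
  · rw [Finset.piecewise_univ] at h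
    exact h
  · intro s _ hs
    obtain ⟨a, ha⟩ : ∃ a, a ∉ s := by simpa [Finset.eq_univ_iff_forall] using hs
    rw [← Function.update_eq_self a (s.piecewise v fun a => c a • u),
      Finset.piecewise_eq_of_notMem _ _ _ ha, MultilinearMap.map_update_smul]
    refine smul_eq_zero_of_right _ ?_
    refine f.map_eq_zero_of_eq (i := 0) (j := a.succ) _ ?_ (Fin.succ_ne_zero a).symm
    simp

lemma projSph_apply {m : ℕ} (u v : Vec m) : projSph m u v = v - dotLin m u v • u := rfl

lemma hodge_projSph_curryLeft {m j l : ℕ} (h : j + (l + 1) = m) (u : Vec m)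
    (α : Vec m [⋀^Fin j]→ₗ[ℝ] ℝ) :
    (hodge h (α.compLinearMap (projSph m u))).curryLeft u = (hodge h α).curryLeft u := by
  subst h
  ext w
  rw [AlternatingMap.curryLeft_apply_apply, AlternatingMap.curryLeft_apply_apply, hodge_apply,
    hodge_apply]
  congr 1
  obtain ⟨F, hF⟩ := exists_multilinearMap_append (volForm (j + (l + 1))) (Matrix.vecCons u w)
  have hP : ∀ g : Fin j → Fin (j + (l + 1)),
      F (fun i => projSph _ u (stdTuple g i)) = F (stdTuple g) := by
    intro g
    rw [hF, hF, map_append_vecCons, map_append_vecCons]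
    congr 1
    rw [← curryLeft_add_smul (k := j + l) _ u (Fin.append (stdTuple g) w)
      (Fin.append (fun i => -dotLin _ u (stdTuple g i)) fun _ => 0)]
    congr 1
    funext x
    refine Fin.addCases (fun a => ?_) (fun a => ?_) x
    · simp [projSph_apply, sub_eq_add_neg]
    · simp
  have h1 := sum_map_mul_of_symmetric α.toMultilinearMap F (projSph _ u) fun a b => by
    simp only [projSph_apply, dotLin_apply, Pi.sub_apply, Pi.smul_apply, Pi.single_apply,
      mul_ite, mul_one, mul_zero, Finset.sum_ite_eq', Finset.mem_univ,
      if_true, smul_eq_mul, eq_comm (a := a)]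
    ring
  simp only [hP, hF] at h1
  exact h1

lemma castFormOn_starSph_resSph {m j l p : ℕ} (h : j + (l + 1) = m) (hp : p = l)
    (hp' : m - (1 + j) = p) (δ : Form m j) :
    castFormOn (hp'.trans hp) (starSph m j (resSph m j δ))
      = (-1 : ℝ) ^ j • resSph m l (iU fun x => hodge h (δ x)) := by
  subst hp
  funext u
  have h1 := hodge_nuForm_wedge h (by omega) u.1 ((δ u.1).compLinearMap (projSph m u.1))
  rw [hodge_projSph_curryLeft] at h1
  exact congrArg (fun f => f.compLinearMap (projSph m u.1)) h1

lemma dotLin_reflFun {m : ℕ} (i : Fin m) (u v : Vec m) :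
    dotLin m (reflFun m i u) (reflLin m i v) = dotLin m u v := by
  rw [dotLin_apply, dotLin_apply]
  refine Finset.sum_congr rfl fun j _ => ?_
  rw [reflFun_apply, reflLin_apply]
  linear_combination (u j * v j) * reflSign_mul_self i j

lemma projSph_reflFun {m : ℕ} (i : Fin m) (u v : Vec m) :
    projSph m (reflFun m i u) (reflLin m i v) = reflLin m i (projSph m u v) := by
  rw [projSph_apply, projSph_apply, dotLin_reflFun, map_sub, map_smul, reflLin_eq i u]

lemma reflPullSph_resSph {m k : ℕ} (i : Fin m) (α : Form m k) :
    reflPullSph m k i (resSph m k α) = resSph m k (reflPull m k i α) := by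
  funext u
  ext v
  exact congrArg (α (reflFun m i u.1)) (funext fun a => projSph_reflFun i u.1 (v a))

lemma reflPull_reflPull {m k : ℕ} (i : Fin m) (α : Form m k) :
    reflPull m k i (reflPull m k i α) = α := by
  funext u
  ext v
  simp only [reflPull, reflFun_reflFun, AlternatingMap.compLinearMap_apply, reflLin_reflLin]

lemma reflPull_comm {m k : ℕ} (i i' : Fin m) (α : Form m k) :
    reflPull m k i (reflPull m k i' α) = reflPull m k i' (reflPull m k i α) := by
  have h : ∀ u, reflFun m i (reflFun m i' u) = reflFun m i' (reflFun m i u) := by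
    intro u
    ext j
    simp only [reflFun_apply]
    ring
  funext u
  ext v
  simp only [reflPull, AlternatingMap.compLinearMap_apply, reflLin_eq, h]

lemma exists_reflPull_eq_neg {m k : ℕ} {r : ℤ} {b : FormOn m (sphereSet m) k}
    (hb : b ∈ PLsph m k r) (ho : IsOddSph m k b) (s : Finset (Fin m)) :
    ∃ δ ∈ PL m k r, resSph m k δ = b ∧ ∀ i ∈ s, reflPull m k i δ = -δ := by
  induction s using Finset.induction_on with
  | empty =>
    obtain ⟨δ, hδ, rfl⟩ := hb
    exact ⟨δ, hδ, rfl, by simp⟩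
  | insert i s _ ih =>
    obtain ⟨δ, hδ, hres, hs⟩ := ih
    have hlin : ∀ i', reflPull m k i' ((1 / 2 : ℝ) • (δ - reflPull m k i δ))
        = (1 / 2 : ℝ) • (reflPull m k i' δ - reflPull m k i' (reflPull m k i δ)) :=
      fun _ => rfl
    refine ⟨(1 / 2 : ℝ) • (δ - reflPull m k i δ), PL_smul (PL_sub hδ (PL_reflPull i hδ)) _,
      ?_, fun i' hi' => ?_⟩
    · have h : resSph m k ((1 / 2 : ℝ) • (δ - reflPull m k i δ))
          = (1 / 2 : ℝ) • (resSph m k δ - resSph m k (reflPull m k i δ)) := rfl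
      rw [h, ← reflPullSph_resSph, hres, ho i, sub_neg_eq_add, ← two_smul ℝ b, smul_smul]
      norm_num
    · rw [hlin]
      rcases Finset.mem_insert.1 hi' with rfl | hi'
      · rw [reflPull_reflPull]
        module
      · rw [reflPull_comm, hs i' hi', show reflPull m k i (-δ) = -reflPull m k i δ from rfl]
        module

lemma isEven_hodge {m j l : ℕ} (h : j + l = m) {δ : Form m j} (hδ : IsOdd m j δ) :
    IsEven m l fun x => hodge h (δ x) := by
  intro i
  funext u
  have h1 := hodge_compLinearMap_reflLin h i (δ (reflFun m i u))
  have h2 : (δ (reflFun m i u)).compLinearMap (reflLin m i) = -δ u := congrFun (hδ i) u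
  rw [h2, map_neg, neg_inj] at h1
  exact h1.symm

lemma isOdd_of_isEven_hodge {m j l : ℕ} (h : j + l = m) {δ : Form m j}
    (hδ : IsEven m l fun x => hodge h (δ x)) : IsOdd m j δ := by
  intro i
  funext u
  refine hodge_injective h ?_
  have h1 := hodge_compLinearMap_reflLin h i (δ (reflFun m i u))
  have h2 : (hodge h (δ (reflFun m i u))).compLinearMap (reflLin m i) = hodge h (δ u) :=
    congrFun (hδ i) u
  rw [h2, ← map_neg] at h1
  exact h1

lemma sumLin_apply {m : ℕ} (v : Vec m) : sumLin m v = ∑ i, v i := by simp [sumLin]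

lemma projSim_apply {m : ℕ} (v : Vec m) (i : Fin m) :
    projSim m v i = v i - (m : ℝ)⁻¹ * ∑ j, v j := by
  simp [projSim, sumLin_apply]

lemma projSim_of_sum_eq_zero {m : ℕ} {v : Vec m} (h : ∑ i, v i = 0) : projSim m v = v := by
  ext i
  rw [projSim_apply, h, mul_zero, sub_zero]

lemma sum_projSim {m : ℕ} [NeZero m] (v : Vec m) : ∑ i, projSim m v i = 0 := by
  have hm : (m : ℝ) ≠ 0 := Nat.cast_ne_zero.2 (NeZero.ne m)
  simp [projSim_apply, Finset.sum_sub_distrib, hm]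

lemma dotLin_projSph {m : ℕ} {u : Vec m} (hu : u ∈ sphereSet m) (v : Vec m) :
    dotLin m u (projSph m u v) = 0 := by
  have h : dotLin m u u = 1 := by
    rw [dotLin_apply, ← show ∑ i, u i ^ 2 = 1 from hu]
    exact Finset.sum_congr rfl fun i _ => (sq (u i)).symm
  rw [projSph_apply, map_sub, map_smul, h, smul_eq_mul, mul_one, sub_self]

lemma sum_dPhi {m : ℕ} (u v : Vec m) : ∑ i, dPhi m u v i = 2 * dotLin m u v := by
  rw [dotLin_apply, Finset.mul_sum]
  exact Finset.sum_congr rfl fun i _ => by rw [dPhi_apply, mul_assoc]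

lemma phiPullTS_resSim {m k : ℕ} (α : Form m k) :
    phiPullTS m k (resSim m k α) = resSph m k (phiPull m k α) := by
  funext u
  ext v
  refine congrArg (α (Phi m u.1)) (funext fun a => projSim_of_sum_eq_zero ?_)
  exact (sum_dPhi _ _).trans (by rw [dotLin_projSph u.2, mul_zero])

lemma phiPull_iU {m k : ℕ} (β : Form m (k + 1)) :
    (2 : ℝ) • phiPull m k (iU β) = iU (phiPull m (k + 1) β) := by
  funext u
  have h : dPhi m u u = (2 : ℝ) • Phi m u := by
    ext i
    rw [dPhi_apply, Pi.smul_apply, Phi, smul_eq_mul]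
    ring
  have h1 : iU (phiPull m (k + 1) β) u
      = ((β (Phi m u)).curryLeft (dPhi m u u)).compLinearMap (dPhi m u) := by
    ext v
    refine congrArg (β (Phi m u)) (funext fun a => ?_)
    refine Fin.cases rfl (fun _ => rfl) a
  rw [h1, h, map_smul]
  rfl

lemma continuous_of_mem_PL {m k : ℕ} {r : ℤ} {α : Form m k} (hα : α ∈ PL m k r)
    (v : Fin k → Vec m) : Continuous fun x => α x v := by
  obtain ⟨p, -, hp⟩ := hα v
  simp only [hp]
  exact MvPolynomial.continuous_eval p

lemma continuous_iU {m k : ℕ} {r : ℤ} {β : Form m (k + 1)} (hβ : β ∈ PL m (k + 1) r)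
    (v : Fin k → Vec m) : Continuous fun x => iU β x v := by
  have h : ∀ x, iU β x v
      = ∑ a, x a * β x (Matrix.vecCons (Pi.single a 1) v) := by
    intro x
    have h1 := congrArg (evalAt v ∘ₗ (β x).curryLeft) (vec_eq_sum x)
    simp only [map_sum, map_smul] at h1
    exact h1
  simp only [h]
  exact continuous_finsetSum _ fun a _ => (continuous_apply a).mul (continuous_of_mem_PL hβ _)

lemma apply_eq_of_phiPullTS_eq {m k : ℕ} {α₁ α₂ : Form m k}
    (h : phiPullTS m k (resSim m k α₁) = phiPullTS m k (resSim m k α₂)) {x : Vec m}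
    (hx : ∀ i, 0 < x i) (hx' : ∑ i, x i = 1) {w : Fin k → Vec m} (hw : ∀ a, ∑ i, w a i = 0) :
    α₁ x w = α₂ x w := by
  have hsq : ∀ i, Real.sqrt (x i) ^ 2 = x i := fun i => Real.sq_sqrt (hx i).le
  have hu : (fun i => Real.sqrt (x i)) ∈ sphereSet m := by
    change ∑ i, Real.sqrt (x i) ^ 2 = 1
    simp only [hsq, hx']
  have hPhi : Phi m (fun i => Real.sqrt (x i)) = x := funext hsq
  have hd : ∀ a, dPhi m (fun i => Real.sqrt (x i))
      (fun i => w a i / (2 * Real.sqrt (x i))) = w a := by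
    intro a
    ext i
    have := (Real.sqrt_pos.2 (hx i)).ne'
    rw [dPhi_apply]
    field_simp
  have hP : ∀ a, projSph m (fun i => Real.sqrt (x i))
      (fun i => w a i / (2 * Real.sqrt (x i))) = fun i => w a i / (2 * Real.sqrt (x i)) := by
    intro a
    have h2 := sum_dPhi (fun i => Real.sqrt (x i)) fun i => w a i / (2 * Real.sqrt (x i))
    rw [hd, hw] at h2
    rw [projSph_apply, (mul_eq_zero.1 h2.symm).resolve_left two_ne_zero, zero_smul, sub_zero]
  rw [phiPullTS_resSim, phiPullTS_resSim] at h
  have h3 := congrArg (fun f => f (fun a i => w a i / (2 * Real.sqrt (x i))))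
    (congrFun h ⟨_, hu⟩)
  simpa only [resSph, phiPull, AlternatingMap.compLinearMap_apply, hP, hd, hPhi] using h3

lemma resSim_eq_of_phiPullTS_eq {m k : ℕ} [NeZero m] {α₁ α₂ : Form m k}
    (h₁ : ∀ v, Continuous fun x => α₁ x v) (h₂ : ∀ v, Continuous fun x => α₂ x v)
    (h : phiPullTS m k (resSim m k α₁) = phiPullTS m k (resSim m k α₂)) :
    resSim m k α₁ = resSim m k α₂ := by
  funext ⟨x, hx, hx'⟩
  ext v
  change α₁ x (fun a => projSim m (v a)) = α₂ x (fun a => projSim m (v a))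
  let p : ℝ → Vec m := fun t i => (1 - t) * x i + t * (m : ℝ)⁻¹
  have hm : (m : ℝ) ≠ 0 := Nat.cast_ne_zero.2 (NeZero.ne m)
  have hm' : 0 < (m : ℝ)⁻¹ := by have := NeZero.pos m; positivity
  have hp : Continuous p := by fun_prop
  have heq : Set.EqOn (fun t => α₁ (p t) fun a => projSim m (v a))
      (fun t => α₂ (p t) fun a => projSim m (v a)) (Set.Ioo 0 1) := by
    intro t ht
    refine apply_eq_of_phiPullTS_eq h (fun i => ?_) ?_ fun a => sum_projSim (v a)
    · have := mul_nonneg (sub_nonneg.2 ht.2.le) (hx i)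
      have := mul_pos ht.1 hm'
      simp only [p]
      linarith
    · simp only [p, Finset.sum_add_distrib, ← Finset.mul_sum, hx', Finset.sum_const,
        Finset.card_univ, Fintype.card_fin, nsmul_eq_mul]
      field_simp
      ring
  have h0 := heq.closure ((h₁ _).comp hp) ((h₂ _).comp hp)
    (show (0 : ℝ) ∈ closure (Set.Ioo 0 1) by rw [closure_Ioo zero_ne_one]; simp)
  have hp0 : p 0 = x := by ext i; simp [p]
  simpa only [hp0] using h0

theorem stmt1 (n k r : ℕ) (hn : 1 ≤ n) (hk : k ≤ n) (hr : 1 ≤ r) :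
    Set.BijOn (phiPullTS (n + 1) k) (PLmsim (n + 1) k (r : ℤ))
      ((fun β => castFormOn (show (n + 1) - (1 + (n - k)) = k by omega)
          (starSph (n + 1) (n - k) β)) ''
        {β ∈ PLsph (n + 1) (n - k) (2 * (r : ℤ) + k - 1) | IsOddSph (n + 1) (n - k) β}) ∧
    (∀ a b, phiPullTS (n + 1) k (a + b) = phiPullTS (n + 1) k a + phiPullTS (n + 1) k b) ∧
    (∀ (c : ℝ) a, phiPullTS (n + 1) k (c • a) = c • phiPullTS (n + 1) k a) := by
  have hdeg : n - k + (k + 1) = n + 1 := by omega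
  have hr' : ((r - 1 : ℕ) : ℤ) = (r : ℤ) - 1 := by omega
  have hc : (-1 : ℝ) ^ (n - k) * (-1) ^ (n - k) = 1 := by rw [← mul_pow]; simp
  have hstar : ∀ δ : Form (n + 1) (n - k),
      castFormOn (show (n + 1) - (1 + (n - k)) = k by omega)
          (starSph (n + 1) (n - k) (resSph (n + 1) (n - k) δ))
        = (-1 : ℝ) ^ (n - k) • resSph (n + 1) k (iU fun x => hodge hdeg (δ x)) :=
    castFormOn_starSph_resSph hdeg rfl (by omega)
  have hphi : ∀ β : Form (n + 1) (k + 1),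
      phiPullTS (n + 1) k (resSim (n + 1) k (iU β))
        = (1 / 2 : ℝ) • resSph (n + 1) k (iU (phiPull (n + 1) (k + 1) β)) := by
    intro β
    rw [phiPullTS_resSim, ← phiPull_iU]
    change _ = (1 / 2 : ℝ) • (2 : ℝ) • resSph (n + 1) k (phiPull (n + 1) k (iU β))
    rw [smul_smul]
    norm_num
  refine ⟨⟨?_, ?_, ?_⟩, fun _ _ => rfl, fun _ _ => rfl⟩
  · rintro _ ⟨_, ⟨β, hβ, rfl⟩, rfl⟩
    let γ := ((-1 : ℝ) ^ (n - k) * (1 / 2)) • phiPull (n + 1) (k + 1) β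
    have hγ : γ ∈ PL (n + 1) (k + 1) (2 * (r : ℤ) + k - 1) := by
      rw [← hr'] at hβ
      have h := phiPull_mem_PL hβ
      rw [show ((2 * (r - 1) + (k + 1) : ℕ) : ℤ) = 2 * (r : ℤ) + k - 1 by omega] at h
      exact PL_smul h _
    have hγe : IsEven (n + 1) (k + 1) γ := fun i =>
      congrArg (((-1 : ℝ) ^ (n - k) * (1 / 2)) • ·) (isEven_phiPull β i)
    let δ : Form (n + 1) (n - k) := fun x => (hodgeEquiv hdeg).symm (γ x)
    have hδγ : (fun x => hodge hdeg (δ x)) = γ :=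
      funext fun x => (hodgeEquiv hdeg).apply_symm_apply (γ x)
    have hδ : δ ∈ PL (n + 1) (n - k) (2 * (r : ℤ) + k - 1) :=
      PL_map hγ (hodgeEquiv hdeg).symm.toLinearMap
    refine ⟨resSph (n + 1) (n - k) δ, ⟨⟨δ, hδ, rfl⟩, fun i => ?_⟩, ?_⟩
    · rw [reflPullSph_resSph, isOdd_of_isEven_hodge hdeg (hδγ ▸ hγe) i]
      rfl
    · change castFormOn _ (starSph (n + 1) (n - k) _) = _
      rw [hstar, hδγ, hphi]
      change (-1 : ℝ) ^ (n - k) • ((-1 : ℝ) ^ (n - k) * (1 / 2)) •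
        resSph (n + 1) k (iU (phiPull (n + 1) (k + 1) β)) = _
      rw [smul_smul, ← mul_assoc, hc, one_mul]
  · rintro _ ⟨_, ⟨β₁, hβ₁, rfl⟩, rfl⟩ _ ⟨_, ⟨β₂, hβ₂, rfl⟩, rfl⟩ h
    exact resSim_eq_of_phiPullTS_eq (continuous_iU hβ₁) (continuous_iU hβ₂) h
  · rintro _ ⟨b, ⟨hb, hbo⟩, rfl⟩
    obtain ⟨δ, hδ, rfl, hδo⟩ := exists_reflPull_eq_neg hb hbo Finset.univ
    let γ : Form (n + 1) (k + 1) := (2 * (-1 : ℝ) ^ (n - k)) • fun x => hodge hdeg (δ x)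
    have hγ : γ ∈ PL (n + 1) (k + 1) (2 * ((r : ℤ) - 1) + (k + 1 : ℕ)) := by
      rw [show 2 * ((r : ℤ) - 1) + (k + 1 : ℕ) = 2 * (r : ℤ) + k - 1 by push_cast; ring]
      exact PL_smul (PL_map hδ _) _
    have hγe : IsEven (n + 1) (k + 1) γ := fun i => congrArg ((2 * (-1 : ℝ) ^ (n - k)) • ·)
      (isEven_hodge hdeg (fun i => hδo i (Finset.mem_univ i)) i)
    obtain ⟨β, hβ, hβγ⟩ := exists_phiPull_eq hγ hγe
    refine ⟨resSim (n + 1) k (iU β), ⟨iU β, ⟨β, hβ, rfl⟩, rfl⟩, ?_⟩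
    change _ = castFormOn _ (starSph (n + 1) (n - k) _)
    rw [hstar, hphi, hβγ]
    change (1 / 2 : ℝ) • (2 * (-1 : ℝ) ^ (n - k)) •
      resSph (n + 1) k (iU fun x => hodge hdeg (δ x)) = _
    rw [smul_smul]
    congr 1
    ring

end
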